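/- In M₂(ℂ), let γ₁ := diag(1,0), γ₂ := diag(0,1), U := diag(e^{i}, 1), θ(x) := U x U*, and ρ := diag(λ, 1−λ) for λ ∈ ℝ with 0 ≤ λ ≤ 1. For n ≥ 1 and i : Fin n → Fin 2 set P_i := Tr(Γ_i ρ Γ_i*) with Γ_i := θⁿ(γ_{i(n)}) ⋯ θ(γ_{i(1)}), and S_n := ∑_{i : Fin n → Fin 2} (−(Re P_i) · log(Re P_i)) with 0 · log 0 = 0. Then the dynamical entropy of θ with respect to the partition {γ₁, γ₂} vanishes: the sequence (1/n) · S_n tends to 0 as n → ∞. -/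

import Mathlib

open Matrix BigOperators

/-- The partition of unity `γ₁ = diag(1,0)`, `γ₂ = diag(0,1)` of the spin model. -/
noncomputable def spinGamma : Fin 2 → Matrix (Fin 2) (Fin 2) ℂ :=
  ![!![1, 0; 0, 0], !![0, 0; 0, 1]]

/-- The unitary `U = diag(eⁱ, 1)` implementing the evolution `θ(x) = U x Uᴴ`. -/
noncomputable def spinU : Matrix (Fin 2) (Fin 2) ℂ :=
  !![Complex.exp Complex.I, 0; 0, 1]

/-- The density matrix `ρ = diag(λ, 1−λ)`. -/
noncomputable def spinRho (l : ℝ) : Matrix (Fin 2) (Fin 2) ℂ :=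
  !![(l : ℂ), 0; 0, 1 - (l : ℂ)]

/-- `Γ_i = θⁿ(γ_{i(n)}) θ^{n−1}(γ_{i(n−1)}) ⋯ θ(γ_{i(1)})` where `θᵏ(x) = Uᵏ x (Uᵏ)ᴴ`. -/
noncomputable def spinGammaOp (n : ℕ) (i : Fin n → Fin 2) : Matrix (Fin 2) (Fin 2) ℂ :=
  (List.ofFn fun k : Fin n =>
    spinU ^ ((Fin.rev k : ℕ) + 1) * spinGamma (i (Fin.rev k)) *
      (spinU ^ ((Fin.rev k : ℕ) + 1))ᴴ).prod

/-- The `n`-step entropy `S_n = ∑_i −(Re P_i) log (Re P_i)` with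
`P_i = Tr(Γ_i ρ Γ_iᴴ)` and the convention `0 log 0 = 0`. -/
noncomputable def spinEntropy (l : ℝ) (n : ℕ) : ℝ :=
  ∑ i : Fin n → Fin 2,
    Real.negMulLog ((spinGammaOp n i * spinRho l * (spinGammaOp n i)ᴴ).trace.re)


theorem spinU_pow (k : ℕ) :
    spinU ^ k = diagonal ![Complex.exp Complex.I ^ k, 1] := by
  have h : spinU = diagonal ![Complex.exp Complex.I, 1] := by
    ext a b; fin_cases a <;> fin_cases b <;> simp [spinU]
  rw [h, diagonal_pow]
  congr 1
  ext a; fin_cases a <;> simp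

theorem spinGamma_eq_diagonal (a : Fin 2) :
    spinGamma a = diagonal (Pi.single a 1) := by
  ext b c; fin_cases a <;> fin_cases b <;> fin_cases c <;> simp [spinGamma]

/-- The evolution fixes the members of the partition. -/
theorem spinU_conj_spinGamma (k : ℕ) (a : Fin 2) :
    spinU ^ k * spinGamma a * (spinU ^ k)ᴴ = spinGamma a := by
  have h : Complex.exp Complex.I ^ k * (starRingEnd ℂ) (Complex.exp Complex.I) ^ k = 1 := by
    rw [← mul_pow, ← Complex.exp_conj, ← Complex.exp_add]
    simp
  rw [spinU_pow, spinGamma_eq_diagonal, diagonal_conjTranspose, diagonal_mul_diagonal,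
    diagonal_mul_diagonal]
  congr 1
  ext b; fin_cases a <;> fin_cases b <;> simp [h]

theorem prod_ofFn_spinGamma (n : ℕ) (i : Fin n → Fin 2) :
    (List.ofFn fun k => spinGamma (i k)).prod =
      diagonal fun j => if ∀ k, i k = j then 1 else 0 := by
  induction n with
  | zero => simp
  | succ n ih =>
    rw [List.ofFn_succ, List.prod_cons, ih, spinGamma_eq_diagonal, diagonal_mul_diagonal]
    congr 1
    ext j
    simp only [Pi.single_apply, Fin.forall_fin_succ, eq_comm (a := j), ite_and, ite_mul, one_mul,
      zero_mul]

theorem spinGammaOp_eq_diagonal (n : ℕ) (i : Fin n → Fin 2) :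
    spinGammaOp n i = diagonal fun j => if ∀ k, i k = j then 1 else 0 := by
  simp only [spinGammaOp, spinU_conj_spinGamma]
  rw [prod_ofFn_spinGamma n fun k => i (Fin.rev k)]
  simp only [Fin.rev_surjective.forall (p := fun k => i k = _)]

theorem spin_probability (l : ℝ) (n : ℕ) (i : Fin n → Fin 2) :
    (spinGammaOp n i * spinRho l * (spinGammaOp n i)ᴴ).trace.re =
      (if ∀ k, i k = 0 then l else 0) + if ∀ k, i k = 1 then 1 - l else 0 := by
  rw [spinGammaOp_eq_diagonal, trace_fin_two, diagonal_conjTranspose, mul_diagonal, mul_diagonal,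
    diagonal_mul, diagonal_mul]
  simp only [spinRho, Complex.add_re]
  congr 1 <;> split_ifs <;> simp_all

theorem spinEntropy_eq (l : ℝ) {n : ℕ} (hn : n ≠ 0) :
    spinEntropy l n = Real.negMulLog l + Real.negMulLog (1 - l) := by
  have : NeZero n := ⟨hn⟩
  have hterm (i : Fin n → Fin 2) :
      Real.negMulLog ((spinGammaOp n i * spinRho l * (spinGammaOp n i)ᴴ).trace.re) =
        (if i = fun _ => 0 then Real.negMulLog l else 0) +
          if i = fun _ => 1 then Real.negMulLog (1 - l) else 0 := by
    rw [spin_probability]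
    simp only [funext_iff]
    by_cases h0 : ∀ k, i k = 0
    · have h1 : ¬ ∀ k, i k = 1 := fun h => by simpa [h0] using h 0
      simp only [if_pos h0, if_neg h1, add_zero]
    · simp only [if_neg h0, zero_add]
      split_ifs <;> simp
  simp only [spinEntropy, hterm, Finset.sum_add_distrib, Finset.sum_ite_eq', Finset.mem_univ,
    if_true]

/-- the dynamical entropy of `θ` w.r.t. the partition `{γ₁, γ₂}`
vanishes: `(1/n) · S_n → 0` as `n → ∞`. -/
theorem stmt14 (l : ℝ) (hl0 : 0 ≤ l) (hl1 : l ≤ 1) :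
    Filter.Tendsto (fun n : ℕ => (1 / (n : ℝ)) * spinEntropy l n)
      Filter.atTop (nhds 0) := by
  have h := (tendsto_one_div_atTop_nhds_zero_nat (𝕜 := ℝ)).mul_const
    (Real.negMulLog l + Real.negMulLog (1 - l))
  rw [zero_mul] at h
  refine h.congr' ?_
  filter_upwards [Filter.eventually_ne_atTop 0] with n hn
  rw [spinEntropy_eq l hn]
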